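/- Fix n ≥ 1 and equip ℂ^{2n} (with coordinates x₁,…,x_{2n}) with the standard symplectic bilinear form ω̃(u,v) = Σ_{j=1}^{n} (u_j v_{n+j} − u_{n+j} v_j). Then the group generated by symplectic shears is dense in the group of symplectic holomorphic automorphisms of ℂ^{2n}: for every holomorphic automorphism F of ℂ^{2n} satisfying ω̃(dF_x(u), dF_x(v)) = ω̃(u,v) for all x, u, v ∈ ℂ^{2n}, every compact set K ⊆ ℂ^{2n}, and every ε > 0, there is a finite composition ψ of symplectic shears with ‖ψ(x) − F(x)‖ < ε for all x ∈ K. -/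

import Mathlib

noncomputable section

/-- The standard symplectic bilinear form on ℂ^{2n}:
`ω̃(u,v) = Σ_{j=1}^n (u_j v_{n+j} − u_{n+j} v_j)`. -/
def symplecticForm (n : ℕ) (u v : EuclideanSpace ℂ (Fin (n + n))) : ℂ :=
  ∑ j : Fin n,
    (u (Fin.castAdd n j) * v (Fin.natAdd n j) - u (Fin.natAdd n j) * v (Fin.castAdd n j))

/-- A symplectic shear of ℂ^{2n}: a map `x ↦ x + f(ω̃(x,v))·v` with `v ∈ ℂ^{2n}` and
`f : ℂ → ℂ` a polynomial. -/
def IsSymplecticShear (n : ℕ)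
    (ψ : EuclideanSpace ℂ (Fin (n + n)) → EuclideanSpace ℂ (Fin (n + n))) : Prop :=
  ∃ (v : EuclideanSpace ℂ (Fin (n + n))) (f : Polynomial ℂ),
    ∀ x, ψ x = x + (Polynomial.eval (symplecticForm n x v) f) • v

/-- A finite composition of symplectic shears. -/
def IsSymplecticShearComposition (n : ℕ)
    (ψ : EuclideanSpace ℂ (Fin (n + n)) → EuclideanSpace ℂ (Fin (n + n))) : Prop :=
  ∃ L : List (EuclideanSpace ℂ (Fin (n + n)) → EuclideanSpace ℂ (Fin (n + n))),
    L ≠ [] ∧ (∀ φ ∈ L, IsSymplecticShear n φ) ∧ ψ = L.foldr (· ∘ ·) id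

/-- A holomorphic automorphism of ℂ^{2n}. -/
def IsHolomorphicAutomorphism (n : ℕ)
    (F : EuclideanSpace ℂ (Fin (n + n)) → EuclideanSpace ℂ (Fin (n + n))) : Prop :=
  Differentiable ℂ F ∧ ∃ G, Differentiable ℂ G ∧ (∀ z, G (F z) = z) ∧ (∀ z, F (G z) = z)

section Holomorphic

variable {E F : Type*} [NormedAddCommGroup E] [NormedSpace ℂ E]
  [NormedAddCommGroup F] [NormedSpace ℂ F]

theorem differentiable_comp_line {f : E → F} (hf : Differentiable ℂ f) (x u : E) :
    Differentiable ℂ fun c : ℂ => f (x + c • u) := by fun_prop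

theorem deriv_comp_line {f : E → F} (hf : Differentiable ℂ f) (x u : E) :
    deriv (fun c : ℂ => f (x + c • u)) 0 = fderiv ℂ f x u := by
  have h1 : HasDerivAt (fun c : ℂ => x + c • u) u 0 := by
    simpa using ((hasDerivAt_id (0 : ℂ)).smul_const u).const_add x
  have h2 : HasFDerivAt f (fderiv ℂ f x) (x + (0 : ℂ) • u) := by
    simpa using (hf x).hasFDerivAt
  exact (h2.comp_hasDerivAt (0 : ℂ) h1).deriv

/-- Cauchy's estimate for the Fréchet derivative of an entire map. -/
theorem norm_fderiv_le_of_forall_closedBall {f : E → F} (hf : Differentiable ℂ f) {x : E} {C : ℝ}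
    (hC : ∀ y ∈ Metric.closedBall x 1, ‖f y‖ ≤ C) : ‖fderiv ℂ f x‖ ≤ C := by
  have hC0 : 0 ≤ C := (norm_nonneg _).trans (hC x (by simp))
  refine ContinuousLinearMap.opNorm_le_bound _ hC0 fun u => ?_
  rcases eq_or_ne u 0 with rfl | hu
  · simp
  have hu' : 0 < ‖u‖ := norm_pos_iff.2 hu
  rw [← deriv_comp_line hf]
  refine (Complex.norm_deriv_le_of_forall_mem_sphere_norm_le (inv_pos.2 hu')
    (differentiable_comp_line hf x u).diffContOnCl (C := C) fun z hz => hC _ ?_).trans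
    (by rw [div_inv_eq_mul])
  have hz : ‖z‖ = ‖u‖⁻¹ := by simpa using hz
  simp [norm_smul, hz, hu'.ne']

variable [FiniteDimensional ℂ E] [FiniteDimensional ℂ F]

theorem differentiable_integral_smul_comp_add {f : E → F} (hf : Differentiable ℂ f)
    {c : ℝ → ℂ} (hc : Continuous c) {γ : ℝ → E} (hγ : Continuous γ) (a b : ℝ) :
    Differentiable ℂ fun x => ∫ θ in a..b, c θ • f (x + γ θ) := by
  intro x₀
  have : ProperSpace E := FiniteDimensional.proper ℂ E
  obtain ⟨R, hR⟩ := (isCompact_uIcc.image hγ : IsCompact (γ '' Set.uIcc a b)).isBounded.exists_norm_le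
  obtain ⟨C, hC⟩ := ((isCompact_closedBall x₀ (2 + R)).image hf.continuous).isBounded.exists_norm_le
  obtain ⟨D, hD⟩ := ((isCompact_uIcc (a := a) (b := b)).image hc).isBounded.exists_norm_le
  have hcont : ∀ x, Continuous fun θ => c θ • f (x + γ θ) := fun x =>
    hc.smul (hf.continuous.comp (continuous_const.add hγ))
  borelize E
  borelize (E →L[ℂ] F)
  have : ProperSpace (E →L[ℂ] F) := FiniteDimensional.proper ℂ _
  refine (intervalIntegral.hasFDerivAt_integral_of_dominated_of_fderiv_le
    (F' := fun x θ => c θ • fderiv ℂ f (x + γ θ)) (bound := fun _ => D * C)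
    (Metric.ball_mem_nhds x₀ one_pos) (.of_forall fun x => (hcont x).aestronglyMeasurable)
    ((hcont x₀).intervalIntegrable _ _) ?_ ?_ (by simp) ?_).differentiableAt
  · refine hc.aestronglyMeasurable.smul (Measurable.aestronglyMeasurable ?_)
    exact (measurable_fderiv ℂ f).comp (measurable_const.add hγ.measurable)
  · refine .of_forall fun θ hθ x hx => ?_
    have hθ' := Set.uIoc_subset_uIcc hθ
    have h1 := hD _ ⟨θ, hθ', rfl⟩
    have h2 := hR _ ⟨θ, hθ', rfl⟩
    rw [norm_smul]
    refine mul_le_mul h1 (norm_fderiv_le_of_forall_closedBall hf fun y hy => hC _ ⟨y, ?_, rfl⟩)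
      (norm_nonneg _) ((norm_nonneg _).trans h1)
    rw [mem_closedBall_iff_norm] at hy ⊢
    rw [mem_ball_iff_norm] at hx
    calc ‖y - x₀‖ = ‖(y - (x + γ θ)) + (x - x₀) + γ θ‖ := by congr 1; abel
      _ ≤ ‖y - (x + γ θ)‖ + ‖x - x₀‖ + ‖γ θ‖ := norm_add₃_le
      _ ≤ 2 + R := by linarith
  · refine .of_forall fun θ _ x _ => HasFDerivAt.const_smul ?_ (c θ)
    simpa [Function.comp_def] using (hf (x + γ θ)).hasFDerivAt.comp x ((hasFDerivAt_id x).add_const (γ θ))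

/-- The directional derivatives of an entire map are entire. -/
theorem differentiable_fderiv_apply {f : E → F} (hf : Differentiable ℂ f) (u : E) :
    Differentiable ℂ fun x => fderiv ℂ f x u := by
  have key : ∀ x, fderiv ℂ f x u = (2 * Real.pi * Complex.I : ℂ)⁻¹ •
      ∫ θ in (0)..(2 * Real.pi),
        (deriv (circleMap 0 1) θ * (1 / circleMap 0 1 θ ^ 2)) • f (x + circleMap 0 1 θ • u) := by
    intro x
    have h := DiffContOnCl.circleIntegral_one_div_sub_center_pow_smul (R := 1) (c := (0 : ℂ))
      one_pos 1 (differentiable_comp_line hf x u).diffContOnCl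
    rw [iteratedDeriv_one, deriv_comp_line hf] at h
    simp only [circleIntegral, smul_smul] at h
    rw [eq_inv_smul_iff₀ Complex.two_pi_I_ne_zero]
    simpa using h.symm
  simp_rw [key]
  refine (differentiable_integral_smul_comp_add hf ?_ ?_ _ _).const_smul _
  · simp only [deriv_circleMap]
    refine ((continuous_circleMap 0 1).mul continuous_const).mul
      (continuous_const.div ((continuous_circleMap 0 1).pow 2) fun θ => ?_)
    simp
  · exact (continuous_circleMap 0 1).smul continuous_const

theorem Differentiable.contDiff_of_finiteDimensional {f : E → F} (hf : Differentiable ℂ f)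
    (k : ℕ) : ContDiff ℂ k f := by
  induction k generalizing f with
  | zero => exact contDiff_zero.2 hf.continuous
  | succ k ih =>
    push_cast
    exact contDiff_succ_iff_fderiv_apply.2
      ⟨hf, by simp, fun u => ih (differentiable_fderiv_apply hf u)⟩

theorem differentiable_fderiv {f : E → F} (hf : Differentiable ℂ f) :
    Differentiable ℂ (fderiv ℂ f) :=
  ((hf.contDiff_of_finiteDimensional 2).fderiv_right (m := 1) (by norm_num)).differentiable
    one_ne_zero

end Holomorphic

section Taylor

open Nat

variable {E : Type*} [NormedAddCommGroup E] [NormedSpace ℂ E] [FiniteDimensional ℂ E]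

theorem hasSum_iteratedFDeriv_zero {f : E → ℂ} (hf : Differentiable ℂ f) (x : E) :
    HasSum (fun k : ℕ => (k ! : ℂ)⁻¹ * iteratedFDeriv ℂ k f 0 fun _ => x) (f x) ∧
      ∀ {C : ℝ}, (∀ y ∈ Metric.closedBall (0 : E) (2 * ‖x‖), ‖f y‖ ≤ C) →
        ∀ k : ℕ, ‖(k ! : ℂ)⁻¹ * iteratedFDeriv ℂ k f 0 fun _ => x‖ ≤ C * (1 / 2) ^ k := by
  set g : ℂ → ℂ := f ∘ (ContinuousLinearMap.toSpanSingleton ℂ x) with hg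
  have hgd : Differentiable ℂ g := hf.comp (ContinuousLinearMap.differentiable _)
  have hgk : ∀ k, iteratedDeriv k g 0 = iteratedFDeriv ℂ k f 0 fun _ => x := fun k => by
    rw [iteratedDeriv_eq_iteratedFDeriv, hg,
      ContinuousLinearMap.iteratedFDeriv_comp_right _ (hf.contDiff_of_finiteDimensional k) _ le_rfl]
    simp
  constructor
  · have h := Complex.hasSum_taylorSeries_of_entire hgd 0 1
    simp only [hgk] at h
    simpa [hg] using h
  · intro C hC k
    have h := Complex.norm_iteratedDeriv_le_of_forall_mem_sphere_norm_le (c := 0) (R := 2) (C := C)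
      k two_pos hgd.diffContOnCl fun z hz => hC _ (by
        have hz : ‖z‖ = 2 := by simpa using hz
        simp [norm_smul, hz])
    rw [hgk] at h
    rw [norm_mul, norm_inv, Complex.norm_natCast, inv_mul_le_iff₀ (by positivity)]
    exact h.trans_eq (by rw [one_div, inv_pow]; ring)

/-- Entire functions are uniformly approximated on balls by their Taylor polynomials. -/
theorem exists_sum_iteratedFDeriv_approx {f : E → ℂ} (hf : Differentiable ℂ f) (R : ℝ) {ε : ℝ}
    (hε : 0 < ε) : ∃ N : ℕ, ∀ x ∈ Metric.closedBall (0 : E) R,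
      ‖f x - ∑ k ∈ Finset.range N, (k ! : ℂ)⁻¹ * iteratedFDeriv ℂ k f 0 fun _ => x‖ ≤ ε := by
  have : ProperSpace E := FiniteDimensional.proper ℂ E
  obtain ⟨C, hC⟩ :=
    ((isCompact_closedBall (0 : E) (2 * R)).image hf.continuous).isBounded.exists_norm_le
  have htend : Filter.Tendsto (fun N : ℕ => C * (1 / 2 : ℝ) ^ N / (1 - 1 / 2)) Filter.atTop
      (nhds 0) := by
    simpa using ((tendsto_pow_atTop_nhds_zero_of_lt_one (r := (1 / 2 : ℝ)) (by norm_num)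
      (by norm_num)).const_mul C).div_const (1 - 1 / 2)
  obtain ⟨N, hN⟩ := (htend.eventually (gt_mem_nhds hε)).exists
  refine ⟨N, fun x hx => ?_⟩
  rw [mem_closedBall_zero_iff] at hx
  obtain ⟨hs, hb⟩ := hasSum_iteratedFDeriv_zero hf x
  rw [norm_sub_rev]
  refine (norm_sub_le_of_geometric_bound_of_hasSum (by norm_num : (1 / 2 : ℝ) < 1)
    (hb (C := C) fun y hy => hC _ ⟨y, ?_, rfl⟩) hs N).trans hN.le
  rw [mem_closedBall_zero_iff] at hy ⊢
  linarith

end Taylor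

theorem Submodule.mem_of_forall_sum_pow_smul_mem {K M : Type*} [Field K] [Infinite K]
    [AddCommGroup M] [Module K M] (S : Submodule K M) {N : ℕ} {m : ℕ → M}
    (h : ∀ c : K, ∑ i ∈ Finset.range N, c ^ i • m i ∈ S) {i : ℕ} (hi : i < N) : m i ∈ S := by
  by_contra hm
  obtain ⟨f, hf, hS⟩ := S.exists_le_ker_of_notMem hm
  have hp : ∑ i ∈ Finset.range N, Polynomial.C (f (m i)) * Polynomial.X ^ i = 0 :=
    Polynomial.funext fun c => by
      have h0 : f (∑ i ∈ Finset.range N, c ^ i • m i) = 0 := hS (h c)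
      simp only [map_sum, map_smul, smul_eq_mul] at h0
      simp only [Polynomial.eval_finsetSum, Polynomial.eval_C_mul,
        Polynomial.eval_pow, Polynomial.eval_X, Polynomial.eval_zero]
      simpa only [mul_comm] using h0
  apply hf
  have hc := congrArg (Polynomial.coeff · i) hp
  simp only [Polynomial.finsetSum_coeff, Polynomial.coeff_C_mul_X_pow, Polynomial.coeff_zero] at hc
  simpa [hi] using hc

section Shears

open Polynomial

variable {E : Type*} [NormedAddCommGroup E] [NormedSpace ℂ E] (B : E →L[ℂ] E →L[ℂ] ℂ)

/-- The sum of the infinitesimal shears `x ↦ f (B x v) • v` over a list of pairs `(v, f)`. -/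
noncomputable def shearField (L : List (E × ℂ[X])) (x : E) : E :=
  (L.map fun p => p.2.eval (B x p.1) • p.1).sum

/-- The span of the powers of the linear forms `B · v`. -/
noncomputable def powerSpan : Submodule ℂ (E → ℂ) :=
  Submodule.span ℂ (Set.range fun p : E × ℕ => fun x => B x p.1 ^ p.2)

theorem mul_mem_powerSpan (w : E) {h : E → ℂ} (hh : h ∈ powerSpan B) :
    (fun x => B x w * h x) ∈ powerSpan B := by
  induction hh using Submodule.span_induction with
  | mem h hh =>
    obtain ⟨⟨v, k⟩, rfl⟩ := hh
    have key : ∀ c : ℂ, ∑ i ∈ Finset.range (k + 1 + 1), c ^ i • (fun x : E =>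
        ((k + 1).choose i : ℂ) * (B x w ^ i * B x v ^ (k + 1 - i))) ∈ powerSpan B := fun c => by
      have hs : (fun x => B x (c • w + v) ^ (k + 1)) ∈ powerSpan B :=
        Submodule.subset_span ⟨(c • w + v, k + 1), rfl⟩
      convert! hs using 1
      ext x
      simp only [Finset.sum_apply, Pi.smul_apply, smul_eq_mul, map_add, map_smul, add_pow]
      exact Finset.sum_congr rfl fun i _ => by ring
    have h1 := (powerSpan B).mem_of_forall_sum_pow_smul_mem key (i := 1) (by omega)
    convert! (powerSpan B).smul_mem ((k + 1 : ℂ)⁻¹) h1 using 1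
    ext x
    have : (k + 1 : ℂ) ≠ 0 := by exact_mod_cast k.succ_ne_zero
    simp
    field_simp
  | zero =>
    convert! (powerSpan B).zero_mem using 1
    ext x
    simp
  | add f g _ _ hf hg => simpa [mul_add] using! add_mem hf hg
  | smul c f _ hf =>
    convert! (powerSpan B).smul_mem c hf using 1
    ext x
    simp
    ring

theorem prod_mem_powerSpan {k : ℕ} (w : Fin k → E) :
    (fun x => ∏ j, B x (w j)) ∈ powerSpan B := by
  induction k with
  | zero => exact Submodule.subset_span ⟨(0, 0), by simp⟩
  | succ k ih =>
    simp_rw [Fin.prod_univ_succ]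
    exact mul_mem_powerSpan B (w 0) (ih fun j => w j.succ)

theorem exists_hasFDerivAt_shearField {h : E → ℂ} (hh : h ∈ powerSpan B) :
    ∃ L : List (E × ℂ[X]), ∀ x, HasFDerivAt h (B.flip (shearField B L x)) x := by
  induction hh using Submodule.span_induction with
  | mem h hh =>
    obtain ⟨⟨v, k⟩, rfl⟩ := hh
    refine ⟨[(v, C (k : ℂ) * X ^ (k - 1))], fun x => ?_⟩
    have h1 : HasFDerivAt (fun x => B x v) (B.flip v) x := (B.flip v).hasFDerivAt
    simpa [shearField] using! h1.pow k
  | zero => exact ⟨[], fun x => by simpa [shearField] using! hasFDerivAt_const (0 : ℂ) x⟩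
  | add f g _ _ hf hg =>
    obtain ⟨L, hL⟩ := hf
    obtain ⟨M, hM⟩ := hg
    exact ⟨L ++ M, fun x => by simpa [shearField] using! (hL x).add (hM x)⟩
  | smul c f _ hf =>
    obtain ⟨L, hL⟩ := hf
    refine ⟨L.map fun p => (p.1, C c * p.2), fun x => ?_⟩
    convert! (hL x).const_smul c using 1
    rw [← map_smul]
    congr 1
    simp [shearField, Function.comp_def, mul_smul, List.smul_sum]

variable [FiniteDimensional ℂ E] {B}

theorem exists_apply_eq_of_nondegenerate (hB : ∀ v, (∀ u, B u v = 0) → v = 0) (f : E →ₗ[ℂ] ℂ) :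
    ∃ v, ∀ u, B u v = f u := by
  let T : E →ₗ[ℂ] Module.Dual ℂ E :=
    { toFun := fun v => (B.flip v : E →ₗ[ℂ] ℂ)
      map_add' := fun v w => by ext; simp
      map_smul' := fun c v => by ext; simp }
  have hT : Function.Injective T := (injective_iff_map_eq_zero T).2 fun v hv =>
    hB v fun u => by simpa [T] using LinearMap.congr_fun hv u
  obtain ⟨v, hv⟩ := (LinearMap.injective_iff_surjective_of_finrank_eq_finrank
    Subspace.dual_finrank_eq.symm).1 hT f
  exact ⟨v, fun u => by simpa [T] using LinearMap.congr_fun hv u⟩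

theorem multilinear_mem_powerSpan (hB : ∀ v, (∀ u, B u v = 0) → v = 0) {k : ℕ}
    (m : E [×k]→L[ℂ] ℂ) : (fun x => m fun _ => x) ∈ powerSpan B := by
  let b := Module.finBasis ℂ E
  choose w hw using fun i => exists_apply_eq_of_nondegenerate hB (b.coord i)
  have : (fun x => m fun _ => x) = ∑ r : Fin k → Fin (Module.finrank ℂ E),
      m (fun j => b (r j)) • fun x => ∏ j, B x (w (r j)) := by
    ext x
    conv_lhs => rw [show (fun _ : Fin k => x) = fun _ => ∑ i, B x (w i) • b i from
      funext fun _ => by simp_rw [hw]; exact (b.sum_repr x).symm]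
    rw [ContinuousMultilinearMap.map_sum]
    simp [ContinuousMultilinearMap.map_smul_univ, mul_comm]
  rw [this]
  exact sum_mem fun r _ => Submodule.smul_mem _ _ (prod_mem_powerSpan B _)

/-- Entire Hamiltonian vector fields are uniformly approximated on compact sets by sums of
infinitesimal shears. -/
theorem exists_shearField_approx (hB : ∀ v, (∀ u, B u v = 0) → v = 0) {X : E → E}
    (hX : Differentiable ℂ X)
    (hsymm : ∀ x u v, B u (fderiv ℂ X x v) = B v (fderiv ℂ X x u)) {K : Set E}
    (hK : IsCompact K) {ε : ℝ} (hε : 0 < ε) :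
    ∃ L : List (E × ℂ[X]), ∀ x ∈ K, ‖shearField B L x - X x‖ ≤ ε := by
  have hpot : ∃ H : E → ℂ, ∀ x, HasFDerivAt H (B.flip (X x)) x := by
    obtain ⟨H, hH⟩ :=
      (convex_univ (𝕜 := ℝ) (E := E)).exists_forall_hasFDerivWithinAt_of_hasFDerivWithinAt_symmetric
      (ω := fun x => B.flip (X x))
      (dω := fun x => (B.flip.comp (fderiv ℂ X x)).restrictScalars ℝ)
      (fun x _ => ((B.flip.hasFDerivAt.comp x (hX x).hasFDerivAt).restrictScalars ℝ).hasFDerivWithinAt)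
      (fun x _ u _ v _ => by simpa using hsymm x v u)
    exact ⟨H, fun x => (hH x trivial).hasFDerivAt Filter.univ_mem⟩
  obtain ⟨H, hH⟩ := hpot
  obtain ⟨c, hc, hanti⟩ := LinearMap.exists_antilipschitzWith (B.flip : E →ₗ[ℂ] E →L[ℂ] ℂ)
    (LinearMap.ker_eq_bot'.2 fun v hv => hB v fun u => by
      simpa using congrArg (fun f : E →L[ℂ] ℂ => f u) hv)
  obtain ⟨R, hR⟩ := hK.isBounded.exists_norm_le
  obtain ⟨N, hN⟩ := exists_sum_iteratedFDeriv_approx (fun x => (hH x).differentiableAt) (R + 1)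
    (div_pos hε (NNReal.coe_pos.2 hc))
  have hmem : (fun x => ∑ k ∈ Finset.range N, (k.factorial : ℂ)⁻¹ *
      iteratedFDeriv ℂ k H 0 fun _ => x) ∈ powerSpan B := by
    have := (powerSpan B).sum_mem (t := Finset.range N) fun k _ => (powerSpan B).smul_mem
      (k.factorial : ℂ)⁻¹ (multilinear_mem_powerSpan hB (iteratedFDeriv ℂ k H 0))
    convert! this using 1
    ext x
    simp
  obtain ⟨L, hL⟩ := exists_hasFDerivAt_shearField B hmem
  refine ⟨L, fun x hx => ?_⟩
  have hd := fun y => (hH y).sub (hL y)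
  have h1 := norm_fderiv_le_of_forall_closedBall (fun y => (hd y).differentiableAt)
    (x := x) (C := ε / c) fun y hy => hN y (by
      rw [mem_closedBall_iff_norm] at hy
      rw [mem_closedBall_zero_iff]
      calc ‖y‖ = ‖x + (y - x)‖ := by congr 1; abel
        _ ≤ ‖x‖ + ‖y - x‖ := norm_add_le _ _
        _ ≤ R + 1 := add_le_add (hR x hx) hy)
  rw [(hd x).fderiv] at h1
  have h2 := hanti.le_mul_dist (X x) (shearField B L x)
  rw [dist_eq_norm, dist_eq_norm, norm_sub_rev] at h2
  exact h2.trans ((mul_le_mul_of_nonneg_left h1 c.coe_nonneg).trans_eq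
    (mul_div_cancel₀ _ (NNReal.coe_pos.2 hc).ne'))

end Shears

section ShearMonoid

open Polynomial

variable {E : Type*} [NormedAddCommGroup E] [NormedSpace ℂ E] (B : E →L[ℂ] E →L[ℂ] ℂ)

/-- The monoid of finite compositions of shears `x ↦ x + f (B x v) • v`. -/
noncomputable def shearMonoid : Submonoid (Function.End E) :=
  Submonoid.closure {ψ | ∃ (v : E) (f : ℂ[X]), ∀ x, ψ x = x + f.eval (B x v) • v}

variable {B}

theorem shear_comp_mem_shearMonoid {ψ : E → E} (hψ : ψ ∈ shearMonoid B) (v : E) (f : ℂ[X]) :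
    (fun x => ψ x + f.eval (B (ψ x) v) • v) ∈ shearMonoid B :=
  (shearMonoid B).mul_mem (x := fun x => x + f.eval (B x v) • v)
    (Submonoid.subset_closure ⟨v, f, fun _ => rfl⟩) hψ

theorem add_const_mem_shearMonoid {ψ : E → E} (hψ : ψ ∈ shearMonoid B) (v : E) :
    (fun x => ψ x + v) ∈ shearMonoid B := by
  simpa using shear_comp_mem_shearMonoid hψ v 1

theorem apply_swap (hB : ∀ u, B u u = 0) (u v : E) : B u v = -B v u := by
  have h := hB (u + v)
  simp only [map_add, add_apply, hB, zero_add, add_zero] at h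
  linear_combination h

/-- The symplectic transvection `x ↦ x + c B(x,v) v`. -/
noncomputable def symplecticTransvection (B : E →L[ℂ] E →L[ℂ] ℂ) (v : E) (c : ℂ) : E →ₗ[ℂ] E :=
  LinearMap.id + (c • (B.flip v : E →ₗ[ℂ] ℂ)).smulRight v

@[simp]
theorem symplecticTransvection_apply (v : E) (c : ℂ) (x : E) :
    symplecticTransvection B v c x = x + (c * B x v) • v := by
  simp [symplecticTransvection]

theorem apply_symplecticTransvection (hB : ∀ u, B u u = 0) (v : E) (c : ℂ) (x y : E) :
    B (symplecticTransvection B v c x) (symplecticTransvection B v c y) = B x y := by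
  simp [hB, apply_swap hB v y]
  ring

theorem mem_shearMonoid_of_transvection_comp (hB : ∀ u, B u u = 0) {A : E →ₗ[ℂ] E} (v : E) (c : ℂ)
    (h : (⇑(symplecticTransvection B v c ∘ₗ A) : E → E) ∈ shearMonoid B) :
    (⇑A : E → E) ∈ shearMonoid B := by
  convert! shear_comp_mem_shearMonoid h v (C (-c) * X) using 1
  ext x
  simp [hB]

theorem ker_sub_id_le_transvection_comp {A : E →ₗ[ℂ] E} (hA : ∀ u v, B (A u) (A v) = B u v)
    (u : E) (c : ℂ) : LinearMap.ker (A - LinearMap.id) ≤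
      LinearMap.ker (symplecticTransvection B (A u - u) c ∘ₗ A - LinearMap.id) := by
  intro w hw
  have hw : A w = w := by simpa [sub_eq_zero] using hw
  have h0 := hA w u
  rw [hw] at h0
  simp [hw, h0]

theorem symplectic_transvection_comp (hB : ∀ u, B u u = 0) {A : E →ₗ[ℂ] E}
    (hA : ∀ u v, B (A u) (A v) = B u v) (v : E) (c : ℂ) (x y : E) :
    B ((symplecticTransvection B v c ∘ₗ A) x) ((symplecticTransvection B v c ∘ₗ A) y) = B x y :=
  (apply_symplecticTransvection hB v c _ _).trans (hA x y)

variable [FiniteDimensional ℂ E]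

/-- A linear symplectic map is a composition of symplectic transvections. -/
theorem linear_mem_shearMonoid (hB : ∀ u, B u u = 0) (hnd : ∀ v, (∀ u, B u v = 0) → v = 0)
    {A : E →ₗ[ℂ] E} (hA : ∀ u v, B (A u) (A v) = B u v) : (⇑A : E → E) ∈ shearMonoid B := by
  suffices H : ∀ (k : ℕ) (A : E →ₗ[ℂ] E), (∀ u v, B (A u) (A v) = B u v) →
      Module.finrank ℂ E ≤ Module.finrank ℂ (LinearMap.ker (A - LinearMap.id)) + k →
      (⇑A : E → E) ∈ shearMonoid B from H _ A hA (Nat.le_add_left _ _)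
  intro k
  induction k with
  | zero =>
    intro A _ hk
    have h := Submodule.eq_top_of_finrank_eq (le_antisymm (Submodule.finrank_le _) hk)
    rw [LinearMap.ker_eq_top, sub_eq_zero] at h
    rw [h]
    exact (shearMonoid B).one_mem
  | succ k ih =>
    have moved : ∀ (A : E →ₗ[ℂ] E), (∀ u v, B (A u) (A v) = B u v) →
        Module.finrank ℂ E ≤ Module.finrank ℂ (LinearMap.ker (A - LinearMap.id)) + (k + 1) →
        ∀ u, B (A u) u ≠ 0 → (⇑A : E → E) ∈ shearMonoid B := by
      intro A hA hk u hu
      refine mem_shearMonoid_of_transvection_comp hB (A u - u) (B (A u) u)⁻¹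
        (ih _ (symplectic_transvection_comp hB hA _ _) ?_)
      have hlt : LinearMap.ker (A - LinearMap.id) < LinearMap.ker
          (symplecticTransvection B (A u - u) (B (A u) u)⁻¹ ∘ₗ A - LinearMap.id) := by
        refine lt_of_le_of_ne (ker_sub_id_le_transvection_comp hA u _) fun h => hu ?_
        have hmem : u ∈ LinearMap.ker (A - LinearMap.id) := by
          rw [h]
          simp [hB, hu]
        have hAu : A u = u := by simpa [sub_eq_zero] using hmem
        rw [hAu, hB]
      have := Submodule.finrank_lt_finrank_of_lt hlt
      omega
    intro A hA hk
    by_cases hu : ∃ u, B (A u) u ≠ 0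
    · obtain ⟨u, hu⟩ := hu
      exact moved A hA hk u hu
    push Not at hu
    by_cases h1 : A = LinearMap.id
    · rw [h1]
      exact (shearMonoid B).one_mem
    obtain ⟨u, w, huw⟩ : ∃ u w, B w (A u - u) ≠ 0 := by
      by_contra! h
      exact h1 (LinearMap.ext fun u => sub_eq_zero.1 (hnd _ fun w => h u w))
    refine mem_shearMonoid_of_transvection_comp hB (A w - w) 1
      (moved _ (symplectic_transvection_comp hB hA _ _)
        (hk.trans (Nat.add_le_add_right (Submodule.finrank_mono
          (ker_sub_id_le_transvection_comp hA w 1)) _)) u ?_)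
    have h2 := hu (u + w)
    simp only [map_add, add_apply, hu, zero_add, add_zero] at h2
    have h3 : B (A u) (A w - w) = B w (A u - u) := by
      rw [map_sub, map_sub, hA]
      linear_combination apply_swap hB u w - apply_swap hB (A u) w
    have h4 : B (A w - w) u = B w (A u - u) := by
      rw [map_sub, map_sub, sub_apply]
      linear_combination h2 - apply_swap hB (A u) w
    simp only [LinearMap.comp_apply, symplecticTransvection_apply, one_mul, map_add, map_smul,
      add_apply, smul_apply, hu, h3, h4, zero_add,
      smul_eq_mul]
    exact mul_ne_zero huw huw

end ShearMonoid

section Dynamics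

open Polynomial

variable {E : Type*} [NormedAddCommGroup E] [NormedSpace ℂ E] {B : E →L[ℂ] E →L[ℂ] ℂ}

/-- A sum of infinitesimal shears is the initial velocity of a curve of compositions of shears. -/
theorem exists_curve_shearField (L : List (E × ℂ[X])) :
    ∃ Φ : ℝ × E → E, ContDiff ℝ 1 Φ ∧ (∀ x, Φ (0, x) = x) ∧
      (∀ x, HasDerivAt (fun τ => Φ (τ, x)) (shearField B L x) 0) ∧
      ∀ τ, (fun x => Φ (τ, x)) ∈ shearMonoid B := by
  induction L with
  | nil =>
    exact ⟨Prod.snd, contDiff_snd, fun _ => rfl,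
      fun x => by simpa [shearField] using hasDerivAt_const (0 : ℝ) x,
      fun _ => (shearMonoid B).one_mem⟩
  | cons p L ih =>
    obtain ⟨Φ, hΦ, hΦ0, hΦd, hΦm⟩ := ih
    have hq : ContDiff ℝ 1 fun x : E => p.2.eval (B x p.1) • p.1 :=
      ((((Polynomial.differentiable p.2).contDiff (n := 1)).comp (B.flip p.1).contDiff).smul
        contDiff_const).restrict_scalars ℝ
    refine ⟨fun q => Φ q + q.1 • (p.2.eval (B (Φ q) p.1) • p.1),
      hΦ.add (contDiff_fst.smul (hq.comp hΦ)), fun x => by simp [hΦ0], fun x => ?_, fun τ => ?_⟩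
    · have hd : HasDerivAt (fun τ : ℝ => p.2.eval (B (Φ (τ, x)) p.1) • p.1)
          (deriv (fun τ : ℝ => p.2.eval (B (Φ (τ, x)) p.1) • p.1) 0) 0 :=
        ((hq.differentiable one_ne_zero _).comp (0 : ℝ)
          (hΦd x).differentiableAt).hasDerivAt
      simpa [shearField, hΦ0, add_comm] using! (hΦd x).add ((hasDerivAt_id (0 : ℝ)).smul hd)
    · convert! shear_comp_mem_shearMonoid (hΦm τ) p.1 (C (τ : ℂ) * p.2) using 1
      ext x
      simp [mul_smul]

variable {F G : E → E}

theorem fderiv_apply_fderiv_of_leftInverse (hF : Differentiable ℂ F) (hG : Differentiable ℂ G)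
    (hGF : ∀ x, G (F x) = x) (x u : E) : fderiv ℂ G (F x) (fderiv ℂ F x u) = u := by
  have h := (hG (F x)).hasFDerivAt.comp x (hF x).hasFDerivAt
  have hid : G ∘ F = id := funext hGF
  rw [hid] at h
  exact congrArg (fun T : E →L[ℂ] E => T u) (h.unique (hasFDerivAt_id x))

variable [FiniteDimensional ℂ E]

/-- The difference between the push-forward of the Euler vector field under a symplectic
automorphism and the Euler vector field. -/
noncomputable def eulerDefect (F G : E → E) (w : E) : E := fderiv ℂ F (G w) (G w) - w

theorem differentiable_eulerDefect (hF : Differentiable ℂ F) (hG : Differentiable ℂ G) :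
    Differentiable ℂ (eulerDefect F G) :=
  (((differentiable_fderiv hF).comp hG).clm_apply hG).sub differentiable_id

theorem eulerDefect_symm (hB : ∀ u, B u u = 0) (hF : Differentiable ℂ F)
    (hG : Differentiable ℂ G) (hFG : ∀ x, F (G x) = x)
    (hsymp : ∀ x u v, B (fderiv ℂ F x u) (fderiv ℂ F x v) = B u v) (w u v : E) :
    B u (fderiv ℂ (eulerDefect F G) w v) = B v (fderiv ℂ (eulerDefect F G) w u) := by
  have hFG' := fderiv_apply_fderiv_of_leftInverse hG hF hFG w
  have hF2 := differentiable_fderiv hF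
  have hderiv : ∀ v, fderiv ℂ (eulerDefect F G) w v =
      fderiv ℂ (fderiv ℂ F) (G w) (fderiv ℂ G w v) (G w) := fun v => by
    have h := (((hF2 (G w)).hasFDerivAt.comp w (hG w).hasFDerivAt).clm_apply
      (hG w).hasFDerivAt).sub (hasFDerivAt_id w)
    have h' : HasFDerivAt (eulerDefect F G) _ w := h
    rw [h'.fderiv]
    simp [hFG']
  have hsymm : IsSymmSndFDerivAt ℂ F (G w) :=
    (hF.contDiff_of_finiteDimensional 2).contDiffAt.isSymmSndFDerivAt (by simp)
  have hdiff : ∀ a b, B (fderiv ℂ (fderiv ℂ F) (G w) (G w) a) (fderiv ℂ F (G w) b) +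
      B (fderiv ℂ F (G w) a) (fderiv ℂ (fderiv ℂ F) (G w) (G w) b) = 0 := fun a b => by
    have hda : ∀ a, HasFDerivAt (fun x => fderiv ℂ F x a)
        ((fderiv ℂ (fderiv ℂ F) (G w)).flip a) (G w) := fun a => by
      simpa using! (hF2 (G w)).hasFDerivAt.clm_apply (hasFDerivAt_const a (G w))
    have h := (B.hasFDerivAt.comp (G w) (hda a)).clm_apply (hda b)
    have hconst : (fun x => B (fderiv ℂ F x a) (fderiv ℂ F x b)) = fun _ => B a b :=
      funext fun x => hsymp x a b
    have h' : HasFDerivAt (fun x => B (fderiv ℂ F x a) (fderiv ℂ F x b)) _ (G w) := h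
    rw [hconst] at h'
    have := congrArg (fun T : E →L[ℂ] ℂ => T (G w)) (h'.unique (hasFDerivAt_const _ _))
    simpa [add_comm] using! this
  rw [hderiv, hderiv, hsymm.eq, hsymm.eq (fderiv ℂ G w u)]
  have h := hdiff (fderiv ℂ G w u) (fderiv ℂ G w v)
  rw [hFG', hFG'] at h
  linear_combination h - apply_swap hB v (fderiv ℂ (fderiv ℂ F) (G w) (G w) (fderiv ℂ G w u))

/-- Locally in time, the isotopy `t ↦ t⁻¹ F (t ·)` is followed by compositions of shears up to
an error that is small compared to the elapsed time. -/
theorem exists_local_step (hB : ∀ u, B u u = 0) (hnd : ∀ v, (∀ u, B u v = 0) → v = 0)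
    (hF : Differentiable ℂ F) (hG : Differentiable ℂ G)
    (hGF : ∀ x, G (F x) = x) (hFG : ∀ x, F (G x) = x)
    (hsymp : ∀ x u v, B (fderiv ℂ F x u) (fderiv ℂ F x v) = B u v)
    {T : ℝ} (hT : 0 < T) {K : Set E} (hK : IsCompact K) {δ : ℝ} (hδ : 0 < δ) :
    ∃ h > 0, ∃ φ : ℝ → E → E, (∀ τ, φ τ ∈ shearMonoid B) ∧
      ∀ s t, |s - T| < h → |t - T| < h → s ≤ t → ∀ y ∈ K,
        ‖t⁻¹ • G (t • φ (t - s) (s⁻¹ • F (s • y))) - y‖ ≤ δ * (t - s) := by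
  have hT' : (T : ℂ) ≠ 0 := by exact_mod_cast hT.ne'
  have hFr : ContDiff ℝ 1 F := (hF.contDiff_of_finiteDimensional 1).restrict_scalars ℝ
  have hGr : ContDiff ℝ 1 G := (hG.contDiff_of_finiteDimensional 1).restrict_scalars ℝ
  set X : E → E := fun z => ((T : ℂ)⁻¹ ^ 2) • eulerDefect F G ((T : ℂ) • z) with hX
  have hXd : ∀ z, HasFDerivAt X (((T : ℂ)⁻¹ ^ 2) • (fderiv ℂ (eulerDefect F G) ((T : ℂ) • z)).comp
      ((T : ℂ) • ContinuousLinearMap.id ℂ E)) z := fun z =>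
    ((differentiable_eulerDefect hF hG _).hasFDerivAt.comp z
      ((hasFDerivAt_id z).const_smul (T : ℂ))).const_smul _
  have hXsymm : ∀ z u v, B u (fderiv ℂ X z v) = B v (fderiv ℂ X z u) := fun z u v => by
    rw [(hXd z).fderiv]
    simpa using Or.inl (eulerDefect_symm hB hF hG hFG hsymp ((T : ℂ) • z) u v)
  have hK' : IsCompact ((fun y => T⁻¹ • F (T • y)) '' K) :=
    hK.image ((hF.continuous.comp (continuous_const_smul T)).const_smul _)
  have hGc : Continuous (fderiv ℂ G) := (differentiable_fderiv hG).continuous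
  obtain ⟨C, hC⟩ := ((hK.image (hF.continuous.comp (continuous_const_smul T))).image
    hGc).isBounded.exists_norm_le
  obtain ⟨L, hL⟩ := exists_shearField_approx hnd (fun z => (hXd z).differentiableAt) hXsymm hK'
    (div_pos hδ (by positivity : 0 < |C| + 1))
  obtain ⟨Φ, hΦ, hΦ0, hΦd, hΦm⟩ := exists_curve_shearField (B := B) L
  set W : (ℝ × ℝ) × E → E := fun p =>
    (p.1.1 + p.1.2)⁻¹ • G ((p.1.1 + p.1.2) • Φ (p.1.2, p.1.1⁻¹ • F (p.1.1 • p.2))) with hW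
  have hWd : ∀ p : (ℝ × ℝ) × E, 0 < p.1.1 → 0 < p.1.1 + p.1.2 → ContDiffAt ℝ 1 W p := by
    intro p hp hp'
    have h1 : ContDiffAt ℝ 1 (fun p : (ℝ × ℝ) × E => p.1.1) p := contDiffAt_fst.fst
    have h2 : ContDiffAt ℝ 1 (fun p : (ℝ × ℝ) × E => p.1.2) p := contDiffAt_fst.snd
    exact ((h1.add h2).inv hp'.ne').smul (hGr.contDiffAt.comp p ((h1.add h2).smul
      (hΦ.contDiffAt.comp p (h2.prodMk ((h1.inv hp.ne').smul
        (hFr.contDiffAt.comp p (h1.smul contDiffAt_snd)))))))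
  set D : (ℝ × ℝ) × E → E := fun p => fderiv ℝ W p ((0, 1), 0) with hD
  have hDd : ∀ s τ y, 0 < s → 0 < s + τ → HasDerivAt (fun τ => W ((s, τ), y)) (D ((s, τ), y)) τ :=
    fun s τ y hs hτ => by
      have h1 : HasDerivAt (fun τ : ℝ => ((s, τ), y)) (((0 : ℝ), (1 : ℝ)), (0 : E)) τ :=
        ((hasDerivAt_const τ s).prodMk (hasDerivAt_id τ)).prodMk (hasDerivAt_const τ y)
      exact ((hWd ((s, τ), y) hs hτ).differentiableAt one_ne_zero).hasFDerivAt.comp_hasDerivAt τ h1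
  have hDc : ∀ p : (ℝ × ℝ) × E, 0 < p.1.1 → 0 < p.1.1 + p.1.2 → ContinuousAt D p := fun p hp hp' =>
    ((hWd p hp hp').fderiv_right (m := 0) (by simp)).continuousAt.clm_apply continuousAt_const
  have hD0 : ∀ y ∈ K, ‖D ((T, 0), y)‖ < δ := by
    intro y hy
    set z := T⁻¹ • F (T • y) with hz
    have hTz : T • z = F (T • y) := smul_inv_smul₀ hT.ne' _
    have hval : D ((T, 0), y) = fderiv ℂ G (F (T • y)) (shearField B L z - X z) := by
      have h1 : HasDerivAt (fun τ : ℝ => T + τ) 1 0 := (hasDerivAt_id (0 : ℝ)).const_add T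
      have h2 := h1.smul (hΦd z)
      have h3 : HasFDerivAt G ((fderiv ℂ G (F (T • y))).restrictScalars ℝ)
          ((T + 0) • Φ (0, z)) := by
        rw [add_zero, hΦ0, hTz]
        exact (hG _).hasFDerivAt.restrictScalars ℝ
      have h4 := (h1.inv (by simpa using hT.ne')).smul (h3.comp_hasDerivAt (0 : ℝ) h2)
      have h5 : HasDerivAt (fun τ => W ((T, τ), y)) _ 0 := h4
      rw [(hDd T 0 y hT (by simpa using hT)).unique h5]
      have h6 : fderiv ℂ G (F (T • y)) (X z) = T⁻¹ • y - T⁻¹ • fderiv ℂ G (F (T • y)) z := by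
        have hTz' : (T : ℂ) • z = F (T • y) := by rw [Complex.coe_smul, hTz]
        simp only [hX, eulerDefect]
        rw [hTz', hGF, map_smul, map_sub, fderiv_apply_fderiv_of_leftInverse hF hG hGF, ← hTz',
          map_smul, smul_sub, ← Complex.coe_smul T y, smul_smul, smul_smul,
          ← Complex.coe_smul, ← Complex.coe_smul, Complex.ofReal_inv]
        congr 2 <;> field_simp
      have h7 : G (T • z) = T • y := by rw [hTz, hGF]
      rw [map_sub, h6]
      simp only [Function.comp_def, Pi.smul_apply', add_zero, hΦ0, h7, ContinuousLinearMap.coe_restrictScalars',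
        one_smul, map_add, Pi.inv_apply]
      have h8 : fderiv ℂ G (F (T • y)) (T • shearField B L z) =
          T • fderiv ℂ G (F (T • y)) (shearField B L z) :=
        ((fderiv ℂ G (F (T • y))).restrictScalars ℝ).map_smul T _
      rw [h8, smul_add, inv_smul_smul₀ hT.ne', smul_smul]
      have h9 : -1 / T ^ 2 * T = -T⁻¹ := by field_simp
      rw [h9, neg_smul]
      abel
    rw [hval]
    calc _ ≤ ‖fderiv ℂ G (F (T • y))‖ * ‖shearField B L z - X z‖ :=
          ContinuousLinearMap.le_opNorm _ _
      _ ≤ |C| * (δ / (|C| + 1)) := mul_le_mul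
          ((hC _ ⟨_, ⟨y, hy, rfl⟩, rfl⟩).trans (le_abs_self C)) (hL z ⟨y, hy, rfl⟩)
          (norm_nonneg _) (abs_nonneg _)
      _ < δ := by
          rw [mul_div_assoc', div_lt_iff₀ (by positivity)]
          nlinarith [abs_nonneg C]
  have hev : ∀ᶠ q in nhds (T, (0 : ℝ)), ∀ y ∈ K, 0 < q.1 ∧ 0 < q.1 + q.2 ∧ ‖D (q, y)‖ < δ := by
    refine hK.eventually_forall_of_forall_eventually fun y hy => ?_
    have hc1 : ContinuousAt (fun p : (ℝ × ℝ) × E => p.1.1) ((T, 0), y) := by fun_prop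
    have hc2 : ContinuousAt (fun p : (ℝ × ℝ) × E => p.1.1 + p.1.2) ((T, 0), y) := by fun_prop
    have hT0 : 0 < T + 0 := by simpa using hT
    exact (hc1.eventually (lt_mem_nhds hT)).and ((hc2.eventually (lt_mem_nhds hT0)).and
      ((hDc ((T, 0), y) hT hT0).norm.eventually (gt_mem_nhds (hD0 y hy))))
  obtain ⟨r, hr, hball⟩ := Metric.eventually_nhds_iff.1 hev
  refine ⟨r / 2, by positivity, fun τ x => Φ (τ, x), hΦm, fun s t hs ht hst y hy => ?_⟩
  have hin : ∀ τ ∈ Set.Icc 0 (t - s), 0 < s ∧ 0 < s + τ ∧ ‖D ((s, τ), y)‖ < δ := by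
    intro τ hτ
    refine hball (y := (s, τ)) ?_ y hy
    rw [Prod.dist_eq, max_lt_iff, Real.dist_eq, Real.dist_eq, sub_zero, abs_of_nonneg hτ.1]
    rw [abs_lt] at hs ht
    exact ⟨abs_lt.2 ⟨by linarith, by linarith⟩, by linarith [hτ.2]⟩
  have hs0 := (hin 0 ⟨le_rfl, sub_nonneg.2 hst⟩).1
  have hmv := norm_image_sub_le_of_norm_deriv_le_segment' (f := fun τ => W ((s, τ), y))
    (fun τ hτ => (hDd s τ y hs0 (hin τ hτ).2.1).hasDerivWithinAt)
    (fun τ hτ => (hin τ (Set.Ico_subset_Icc_self hτ)).2.2.le) (t - s)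
    ⟨sub_nonneg.2 hst, le_rfl⟩
  simpa [hW, hΦ0, smul_inv_smul₀ hs0.ne', hGF, inv_smul_smul₀ hs0.ne'] using hmv

end Dynamics

section Density

variable {E : Type*} [NormedAddCommGroup E] [NormedSpace ℂ E] [FiniteDimensional ℂ E]
  {B : E →L[ℂ] E →L[ℂ] ℂ} {F G : E → E}

theorem exists_shearMonoid_approx_of_map_zero (hB : ∀ u, B u u = 0)
    (hnd : ∀ v, (∀ u, B u v = 0) → v = 0) (hF : Differentiable ℂ F) (hG : Differentiable ℂ G)
    (hGF : ∀ x, G (F x) = x) (hFG : ∀ x, F (G x) = x)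
    (hsymp : ∀ x u v, B (fderiv ℂ F x u) (fderiv ℂ F x v) = B u v) (hF0 : F 0 = 0)
    {K : Set E} (hK : IsCompact K) {ε : ℝ} (hε : 0 < ε) :
    ∃ ψ ∈ shearMonoid B, ∀ x ∈ K, ‖ψ x - F x‖ < ε := by
  have : ProperSpace E := FiniteDimensional.proper ℂ E
  obtain ⟨δ', hδ', hFu⟩ : ∃ δ' > 0, ∀ x ∈ K, ∀ y, ‖y - x‖ < δ' → ‖F y - F x‖ < ε := by
    have h := hK.uniformContinuousAt_of_continuousAt F (fun x _ => hF.continuous.continuousAt)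
      (Metric.dist_mem_uniformity hε)
    obtain ⟨δ', hδ', h⟩ := Metric.mem_uniformity_dist.1 h
    refine ⟨δ', hδ', fun x hx y hxy => ?_⟩
    rw [← dist_eq_norm, dist_comm] at hxy ⊢
    exact h hxy hx
  obtain ⟨δ, hδ, hδ1, hδ2⟩ : ∃ δ : ℝ, 0 < δ ∧ 2 * δ < δ' ∧ 2 * δ ≤ 1 :=
    ⟨min (δ' / 4) (1 / 2), by positivity, by linarith [min_le_left (δ' / 4) (1 / 2)],
      by linarith [min_le_right (δ' / 4) (1 / 2)]⟩
  let P : ℝ → Prop := fun t =>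
    ∃ ψ ∈ shearMonoid B, ∀ x ∈ K, ‖t⁻¹ • G (t • ψ x) - x‖ ≤ δ * (1 + t)
  obtain ⟨t₀, ht₀, ht₀1, hP₀⟩ : ∃ t₀ : ℝ, 0 < t₀ ∧ t₀ ≤ 1 ∧ P t₀ := by
    have hG0 : G 0 = 0 := by simpa [hF0] using hGF 0
    have hev : ∀ᶠ t : ℝ in nhdsWithin 0 (Set.Ioi 0), ∀ x ∈ K,
        ‖t⁻¹ • G (t • fderiv ℂ F 0 x) - x‖ < δ := by
      obtain ⟨C, hC⟩ := (hK.image (fderiv ℂ F 0).continuous).isBounded.exists_norm_le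
      have hd := (hG 0).hasFDerivAt
      have hlo := (hasFDerivAt_iff_isLittleO_nhds_zero.1 hd).def
        (div_pos hδ (by positivity : 0 < |C| + 1))
      obtain ⟨r, hr, hball⟩ := Metric.eventually_nhds_iff.1 hlo
      have hr' : 0 < r / (|C| + 1) := by positivity
      filter_upwards [self_mem_nhdsWithin, nhdsWithin_le_nhds (gt_mem_nhds hr')]
        with t (ht : 0 < t) htr x hx
      have hAx : ‖fderiv ℂ F 0 x‖ ≤ |C| := (hC _ ⟨x, hx, rfl⟩).trans (le_abs_self C)
      have hn : ‖t • fderiv ℂ F 0 x‖ = t * ‖fderiv ℂ F 0 x‖ := by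
        rw [norm_smul, Real.norm_of_nonneg ht.le]
      have hlt : t * (|C| + 1) < r := (lt_div_iff₀ (by positivity)).1 htr
      have h := hball (y := t • fderiv ℂ F 0 x) (by
        rw [dist_zero_right, hn]
        nlinarith)
      have hGA : fderiv ℂ G 0 (t • fderiv ℂ F 0 x) = t • x := by
        have h := fderiv_apply_fderiv_of_leftInverse hF hG hGF 0 x
        rw [hF0] at h
        rw [← Complex.coe_smul, map_smul, h, Complex.coe_smul]
      rw [zero_add, hG0, sub_zero, hGA, hn] at h
      have heq : t⁻¹ • G (t • fderiv ℂ F 0 x) - x = t⁻¹ • (G (t • fderiv ℂ F 0 x) - t • x) := by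
        rw [smul_sub, inv_smul_smul₀ ht.ne']
      rw [heq, norm_smul, norm_inv, Real.norm_of_nonneg ht.le, inv_mul_lt_iff₀ ht]
      refine h.trans_lt ?_
      rw [div_mul_eq_mul_div, div_lt_iff₀ (by positivity)]
      have := mul_pos ht hδ
      nlinarith [mul_le_mul_of_nonneg_left hAx this.le]
    have hpos : ∀ᶠ t : ℝ in nhdsWithin 0 (Set.Ioi 0), 0 < t := self_mem_nhdsWithin
    have hle : ∀ᶠ t : ℝ in nhdsWithin 0 (Set.Ioi 0), t ≤ 1 :=
      nhdsWithin_le_nhds (ge_mem_nhds zero_lt_one)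
    obtain ⟨t, ht, ht1, ht2⟩ := (hev.and (hpos.and hle)).exists
    refine ⟨t, ht1, ht2, ⇑(fderiv ℂ F 0), linear_mem_shearMonoid hB hnd
      (A := (fderiv ℂ F 0).toLinearMap) (hsymp 0), fun x hx => (ht x hx).le.trans ?_⟩
    nlinarith
  have hstep : ∀ T : Set.Icc t₀ 1, ∃ h > 0, ∀ s t : ℝ, |s - T| < h → |t - T| < h → 0 < s →
      s ≤ t → s ≤ 1 → P s → P t := by
    rintro ⟨T, hT, hT1⟩
    obtain ⟨h, hh, φ, hφ, H⟩ := exists_local_step hB hnd hF hG hGF hFG hsymp (ht₀.trans_le hT)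
      (hK.cthickening (r := 1)) hδ
    refine ⟨h, hh, fun s t hs ht hs0 hst hs1 => ?_⟩
    rintro ⟨ψ, hψ, hψs⟩
    refine ⟨φ (t - s) ∘ ψ, (shearMonoid B).mul_mem (hφ _) hψ, fun x hx => ?_⟩
    have hy : s⁻¹ • G (s • ψ x) ∈ Metric.cthickening 1 K :=
      Metric.mem_cthickening_of_dist_le _ x _ _ hx (by
        rw [dist_eq_norm]
        nlinarith [hψs x hx])
    have h1 := H s t hs ht hst _ hy
    rw [smul_inv_smul₀ hs0.ne', hFG, inv_smul_smul₀ hs0.ne'] at h1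
    calc _ ≤ _ := norm_sub_le_norm_sub_add_norm_sub _ (s⁻¹ • G (s • ψ x)) _
      _ ≤ δ * (t - s) + δ * (1 + s) := add_le_add h1 (hψs x hx)
      _ = δ * (1 + t) := by ring
  choose h hh hP using hstep
  obtain ⟨τ, hτ0, hτm, ⟨N, hN⟩, hτc⟩ := exists_monotone_Icc_subset_open_cover_Icc
    (c := fun T : Set.Icc t₀ 1 => {s : Set.Icc t₀ 1 | |(s : ℝ) - T| < h T}) ht₀1
    (fun T => isOpen_lt (by fun_prop) continuous_const)
    (fun T _ => Set.mem_iUnion.2 ⟨T, by simpa using hh T⟩)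
  have hPn : ∀ k, P (τ k) := fun k => by
    induction k with
    | zero => rwa [hτ0]
    | succ k ih =>
      obtain ⟨T, hT⟩ := hτc k
      have hle : τ k ≤ τ (k + 1) := hτm k.le_succ
      exact hP T _ _ (hT ⟨le_rfl, hle⟩) (hT ⟨hle, le_rfl⟩) (ht₀.trans_le (τ k).2.1) hle
        (τ k).2.2 ih
  have h1 := hPn N
  rw [hN N le_rfl] at h1
  obtain ⟨ψ, hψ, hψ1⟩ := h1
  refine ⟨ψ, hψ, fun x hx => ?_⟩
  have h2 := hψ1 x hx
  rw [inv_one, one_smul, one_smul] at h2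
  have h3 := hFu x hx (G (ψ x)) (by linarith)
  rwa [hFG] at h3

/-- Compositions of shears are dense in the symplectic holomorphic automorphisms. -/
theorem exists_shearMonoid_approx (hB : ∀ u, B u u = 0)
    (hnd : ∀ v, (∀ u, B u v = 0) → v = 0) (hF : Differentiable ℂ F) (hG : Differentiable ℂ G)
    (hGF : ∀ x, G (F x) = x) (hFG : ∀ x, F (G x) = x)
    (hsymp : ∀ x u v, B (fderiv ℂ F x u) (fderiv ℂ F x v) = B u v)
    {K : Set E} (hK : IsCompact K) {ε : ℝ} (hε : 0 < ε) :
    ∃ ψ ∈ shearMonoid B, ∀ x ∈ K, ‖ψ x - F x‖ < ε := by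
  obtain ⟨ψ, hψ, h⟩ := exists_shearMonoid_approx_of_map_zero hB hnd
    (F := fun x => F x - F 0) (G := fun x => G (x + F 0)) (hF.sub_const _)
    (hG.comp (differentiable_id.add_const _)) (by simpa using hGF) (by simp [hFG])
    (by simpa [fderiv_sub_const] using hsymp) (sub_self _) hK hε
  refine ⟨_, add_const_mem_shearMonoid hψ (F 0), fun x hx => ?_⟩
  convert! h x hx using 2
  abel

end Density

/-- The standard symplectic form as a continuous bilinear map. -/
def symplecticFormL (n : ℕ) : EuclideanSpace ℂ (Fin (n + n)) →L[ℂ]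
    EuclideanSpace ℂ (Fin (n + n)) →L[ℂ] ℂ :=
  ∑ j : Fin n, ((EuclideanSpace.proj (Fin.castAdd n j)).smulRight
      (EuclideanSpace.proj (Fin.natAdd n j)) -
    (EuclideanSpace.proj (Fin.natAdd n j)).smulRight (EuclideanSpace.proj (Fin.castAdd n j)))

@[simp]
theorem symplecticFormL_apply (n : ℕ) (u v : EuclideanSpace ℂ (Fin (n + n))) :
    symplecticFormL n u v = symplecticForm n u v := by
  simp [symplecticFormL, symplecticForm]

theorem symplecticForm_self (n : ℕ) (u : EuclideanSpace ℂ (Fin (n + n))) :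
    symplecticForm n u u = 0 :=
  Finset.sum_eq_zero fun j _ => by ring

theorem eq_zero_of_symplecticForm_eq_zero (n : ℕ) (v : EuclideanSpace ℂ (Fin (n + n)))
    (h : ∀ u, symplecticForm n u v = 0) : v = 0 := by
  have hne : ∀ i j : Fin n, Fin.castAdd n i ≠ j.addNat n := fun i j hij => by
    have := congrArg Fin.val hij
    simp at this
    omega
  ext i
  refine Fin.addCases (fun j => ?_) (fun j => ?_) i
  · have := h (EuclideanSpace.single (Fin.natAdd n j) 1)
    simpa [symplecticForm, Pi.single_apply, hne] using this
  · have := h (EuclideanSpace.single (Fin.castAdd n j) 1)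
    simpa [symplecticForm, Pi.single_apply, (hne _ _).symm] using this

theorem isSymplecticShearComposition_of_mem_shearMonoid {n : ℕ}
    {ψ : EuclideanSpace ℂ (Fin (n + n)) → EuclideanSpace ℂ (Fin (n + n))}
    (hψ : ψ ∈ shearMonoid (symplecticFormL n)) : IsSymplecticShearComposition n ψ := by
  have hid : IsSymplecticShear n id := ⟨0, 0, fun x => by simp⟩
  induction hψ using Submonoid.closure_induction_left with
  | one => exact ⟨[id], by simp, by simpa using hid, rfl⟩
  | mul_left φ hφ ψ _ ih =>
    obtain ⟨L, _, hL, rfl⟩ := ih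
    obtain ⟨v, f, hf⟩ := hφ
    refine ⟨φ :: L, by simp, ?_, rfl⟩
    rintro χ (_ | ⟨_, hχ⟩)
    · exact ⟨v, f, fun x => by simpa using hf x⟩
    · exact hL χ hχ

/-- Forstnerič: the group generated by symplectic shears is dense in the group of symplectic
holomorphic automorphisms of ℂ^{2n}. -/
theorem symplectic_shears_dense (n : ℕ) (hn : 1 ≤ n)
    (F : EuclideanSpace ℂ (Fin (n + n)) → EuclideanSpace ℂ (Fin (n + n)))
    (hF : IsHolomorphicAutomorphism n F)
    (hsymp : ∀ x u v : EuclideanSpace ℂ (Fin (n + n)),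
      symplecticForm n (fderiv ℂ F x u) (fderiv ℂ F x v) = symplecticForm n u v)
    (K : Set (EuclideanSpace ℂ (Fin (n + n)))) (hK : IsCompact K)
    (ε : ℝ) (hε : 0 < ε) :
    ∃ ψ : EuclideanSpace ℂ (Fin (n + n)) → EuclideanSpace ℂ (Fin (n + n)),
      IsSymplecticShearComposition n ψ ∧ ∀ x ∈ K, ‖ψ x - F x‖ < ε := by
  obtain ⟨hFd, G, hG, hGF, hFG⟩ := hF
  obtain ⟨ψ, hψ, h⟩ := exists_shearMonoid_approx (B := symplecticFormL n)
    (by simpa using symplecticForm_self n) (by simpa using eq_zero_of_symplecticForm_eq_zero n)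
    hFd hG hGF hFG (by simpa using hsymp) hK hε
  exact ⟨ψ, isSymplecticShearComposition_of_mem_shearMonoid hψ, h⟩
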